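/- Let n > 2 and let P be a set of unordered pairs {i,j} ⊆ {1,…,n}, i ≠ j, with {1,n} ∉ P. Let q be symmetric (q_{ij} = q_{ji}), with q_{ij} = 1 for every {i,j} ∈ P, with σ_S := ∏_{{i,j}⊆S, i≠j} q_{ij}² ≠ 1 for every proper subset S ⊊ {1,…,n} with |S| ≥ 2 which is not a pair of P, and with σ_{1⋯n} := ∏_{{i,j}⊆{1,…,n}, i≠j} q_{ij}² = 1. On the set of permutations of {1,…,n}, regarded as lists, let ~ be the equivalence relation generated by interchanging two adjacent entries that form a pair belonging to P; since q_{ij} = 1 on P, the assignment M([α],[β]) = ∏ q_{ij}, product over unordered pairs {i,j} ∉ P whose relative order in α differs from their relative order in β, is a well-defined complex matrix indexed by the (finitely many) equivalence classes. Then the dimension of the kernel of M equals the number of equivalence classes all of whose members begin with 1 and end with n. -/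

import Mathlib

noncomputable section

/-- Permutations `α, β` of `{1,…,n}` (regarded as the lists `(α(1),…,α(n))`) are related
when the list of `β` is obtained from that of `α` by interchanging two adjacent entries
forming a pair belonging to `P`. -/
def swapRel {n : ℕ} (P : Finset (Sym2 (Fin n))) (α β : Equiv.Perm (Fin n)) : Prop :=
  ∃ k : ℕ, ∃ h : k + 1 < n,
    s(α ⟨k, by omega⟩, α ⟨k + 1, h⟩) ∈ P ∧
    β = α * Equiv.swap (⟨k, by omega⟩ : Fin n) (⟨k + 1, h⟩ : Fin n)

/-- The setoid on permutations generated by adjacent interchanges of `P`-pairs. -/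
def swapSetoid {n : ℕ} (P : Finset (Sym2 (Fin n))) : Setoid (Equiv.Perm (Fin n)) :=
  Relation.EqvGen.setoid (swapRel P)

instance {n : ℕ} (P : Finset (Sym2 (Fin n))) : Fintype (Quotient (swapSetoid P)) :=
  Fintype.ofFinite _

/-- The entry `M(α,β) = ∏ q_{ij}`, product over unordered pairs `{i,j} ∉ P` whose
relative order in `α` differs from their relative order in `β`. -/
def Mentry {n : ℕ} (q : Fin n → Fin n → ℂ) (P : Finset (Sym2 (Fin n)))
    (α β : Equiv.Perm (Fin n)) : ℂ :=
  ∏ p ∈ Finset.univ.filter (fun p : Fin n × Fin n =>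
      p.1 < p.2 ∧ s(p.1, p.2) ∉ P ∧
      ¬((α.symm p.1 < α.symm p.2) ↔ (β.symm p.1 < β.symm p.2))),
    q p.1 p.2

/-- `σ_S = ∏_{{i,j} ⊆ S, i ≠ j} q_{ij} q_{ji}`, as a product over ordered pairs. -/
def sigmaS {n : ℕ} (q : Fin n → Fin n → ℂ) (S : Finset (Fin n)) : ℂ :=
  ∏ i ∈ S, ∏ j ∈ S, if i ≠ j then q i j else 1

namespace AcyclicOrientation

open scoped Classical

set_option linter.unusedSectionVars false

variable {G : Type*} [Fintype G] [DecidableEq G]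

/-- `r` is an acyclic orientation of the graph with adjacency relation `Γ`. -/
def IsChamber (Γ r : G → G → Prop) : Prop :=
  ∃ f : G → ℕ, (∀ i j, Γ i j → f i ≠ f j) ∧ ∀ i j, r i j ↔ Γ i j ∧ f i < f j

/-- The acyclic orientations of `Γ`. -/
def chambers (Γ : G → G → Prop) : Finset (G → G → Prop) :=
  Finset.univ.filter (IsChamber Γ)

/-- The product of `q` over the edges which `C` and `D` orient differently. -/
def sepWeight (q : G → G → ℂ) (C D : G → G → Prop) : ℂ :=
  ∏ i, ∏ j, if C i j ∧ D j i then q i j else 1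

/-- The restriction of a relation to the pairs not separated by `S`. -/
def cut (S : Finset G) (r : G → G → Prop) : G → G → Prop :=
  fun i j => r i j ∧ (i ∈ S ↔ j ∈ S)

/-- The extension of an orientation of `cut S Γ` in which all other edges leave `S`. -/
def join (Γ : G → G → Prop) (S : Finset G) (r : G → G → Prop) : G → G → Prop :=
  fun i j => r i j ∨ (Γ i j ∧ i ∈ S ∧ j ∉ S)

/-- The product of `q` over the edges of `C` entering `S`. -/
def crossWeight (q : G → G → ℂ) (S : Finset G) (C : G → G → Prop) : ℂ :=
  ∏ i, ∏ j, if C i j ∧ i ∉ S ∧ j ∈ S then q i j else 1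

/-- The weighted projection of `v` to functions on the orientations of `cut S Γ`. -/
def localize (q : G → G → ℂ) (Γ : G → G → Prop) (S : Finset G) (v : (G → G → Prop) → ℂ)
    (r : G → G → Prop) : ℂ :=
  ∑ C ∈ (chambers Γ).filter (fun C => cut S C = r), crossWeight q S C * v C

/-- The action on `v` of the matrix of separation weights of the orientations of `Γ`. -/
def sepApply (q : G → G → ℂ) (Γ : G → G → Prop) (v : (G → G → Prop) → ℂ)
    (D : G → G → Prop) : ℂ :=
  ∑ C ∈ chambers Γ, sepWeight q C D * v C

/-- Reverse `C` inside `S` and let all edges across `S` leave `S`. -/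
def fold (Γ : G → G → Prop) (S : Finset G) (C : G → G → Prop) : G → G → Prop :=
  fun i j => if i ∈ S then (if j ∈ S then C j i else Γ i j) else (if j ∈ S then False else C i j)

/-- The `S`-summand of the antipode identity at `D`. -/
def foldSum (q : G → G → ℂ) (Γ : G → G → Prop) (S : Finset G) (v : (G → G → Prop) → ℂ)
    (D : G → G → Prop) : ℂ :=
  ∑ C ∈ (chambers Γ).filter (fun C => fold Γ S C = D), sepWeight q C D * v C

/-- No edge of `Γ` leaves `K`. -/
def IsClosedUnder (Γ : G → G → Prop) (K : Finset G) : Prop :=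
  ∀ i ∈ K, ∀ j, Γ i j → j ∈ K

/-- `K` induces a connected subgraph of `Γ`. -/
def IsInseparable (Γ : G → G → Prop) (K : Finset G) : Prop :=
  ∀ S ⊆ K, S.Nonempty → S ≠ K → ∃ i ∈ S, ∃ j ∈ K, j ∉ S ∧ Γ i j

/-- The product of `q i j` over ordered pairs of adjacent vertices of `K`. -/
def edgeProd (q : G → G → ℂ) (Γ : G → G → Prop) (K : Finset G) : ℂ :=
  ∏ i, ∏ j, if i ∈ K ∧ j ∈ K ∧ Γ i j then q i j else 1

variable {q : G → G → ℂ} {Γ : G → G → Prop} {v : (G → G → Prop) → ℂ} {C D : G → G → Prop}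
  {S K : Finset G}

lemma mem_chambers : C ∈ chambers Γ ↔ IsChamber Γ C := by
  simp [chambers]

lemma IsChamber.adj (h : IsChamber Γ C) {i j : G} (hC : C i j) : Γ i j := by
  obtain ⟨f, -, h2⟩ := h
  exact ((h2 i j).1 hC).1

lemma IsChamber.asymm (h : IsChamber Γ C) {i j : G} (hC : C i j) : ¬ C j i := by
  obtain ⟨f, -, h2⟩ := h
  intro h'
  have := ((h2 i j).1 hC).2
  have := ((h2 j i).1 h').2
  omega

lemma IsChamber.total (hΓ : ∀ i j, Γ i j → Γ j i) (h : IsChamber Γ C) {i j : G} (hij : Γ i j) :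
    C i j ∨ C j i := by
  obtain ⟨f, h1, h2⟩ := h
  rcases lt_or_gt_of_ne (h1 i j hij) with h | h
  · exact Or.inl ((h2 i j).2 ⟨hij, h⟩)
  · exact Or.inr ((h2 j i).2 ⟨hΓ _ _ hij, h⟩)

lemma IsChamber.irrefl (h : IsChamber Γ C) (i : G) : ¬ Γ i i := by
  obtain ⟨f, h1, -⟩ := h
  exact fun hi => h1 i i hi rfl

lemma IsChamber.exists_source (h : IsChamber Γ C) (hS : S.Nonempty) :
    ∃ x ∈ S, ∀ j ∈ S, ¬ C j x := by
  obtain ⟨f, -, h2⟩ := h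
  obtain ⟨x, hx, hmin⟩ := S.exists_min_image f hS
  refine ⟨x, hx, fun j hj hC => ?_⟩
  have := hmin j hj
  have := ((h2 j x).1 hC).2
  omega

lemma IsChamber.exists_sink (h : IsChamber Γ C) (hS : S.Nonempty) :
    ∃ x ∈ S, ∀ j ∈ S, ¬ C x j := by
  obtain ⟨f, -, h2⟩ := h
  obtain ⟨x, hx, hmin⟩ := S.exists_max_image f hS
  refine ⟨x, hx, fun j hj hC => ?_⟩
  have := hmin j hj
  have := ((h2 x j).1 hC).2
  omega

lemma isChamber_cut (h : IsChamber Γ C) (S : Finset G) : IsChamber (cut S Γ) (cut S C) := by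
  obtain ⟨f, h1, h2⟩ := h
  refine ⟨f, fun i j hij => h1 i j hij.1, fun i j => ?_⟩
  simp only [cut, h2]
  tauto

lemma isChamber_join (h : IsChamber (cut S Γ) C) : IsChamber Γ (join Γ S C) := by
  obtain ⟨f, h1, h2⟩ := h
  have hb : ∀ i, f i ≤ ∑ k, f k := fun i =>
    Finset.single_le_sum (fun _ _ => Nat.zero_le _) (Finset.mem_univ i)
  refine ⟨fun i => if i ∈ S then f i else f i + (∑ k, f k) + 1, fun i j hij => ?_,
    fun i j => ?_⟩
  · have := h1 i j
    have := hb i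
    have := hb j
    simp only [cut] at this h1
    by_cases hi : i ∈ S <;> by_cases hj : j ∈ S <;> simp [hi, hj]
    · exact h1 i j ⟨hij, by simp [hi, hj]⟩
    · omega
    · omega
    · exact h1 i j ⟨hij, by simp [hi, hj]⟩
  · have := hb i
    have := hb j
    simp only [join, h2, cut]
    by_cases hi : i ∈ S <;> by_cases hj : j ∈ S <;> simp [hi, hj]
    · intro _; omega
    · intro _; omega

lemma join_cut (h : IsChamber Γ C) (hΓ : ∀ i j, Γ i j → Γ j i)
    (hS : ∀ i j, i ∉ S → j ∈ S → ¬ C i j) : join Γ S (cut S C) = C := by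
  funext i j
  have h1 := @IsChamber.adj _ _ _ _ _ h i j
  have h2 := @IsChamber.total _ _ _ _ _ hΓ h i j
  have h3 := hS i j
  have h4 := hS j i
  simp only [cut, join, eq_iff_iff]
  tauto

lemma cut_symm (hΓ : ∀ i j, Γ i j → Γ j i) (S : Finset G) (i j : G) (h : cut S Γ i j) :
    cut S Γ j i :=
  ⟨hΓ _ _ h.1, h.2.symm⟩

lemma sepWeight_self (h : IsChamber Γ C) : sepWeight q C C = 1 := by
  refine Finset.prod_eq_one fun i _ => Finset.prod_eq_one fun j _ => ?_
  rw [if_neg]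
  exact fun hC => h.asymm hC.1 hC.2

lemma sepWeight_join (hC : IsChamber Γ C) (hD : IsChamber (cut S Γ) D)
    (hΓ : ∀ i j, Γ i j → Γ j i) :
    sepWeight q C (join Γ S D) = sepWeight q (cut S C) D * crossWeight q S C := by
  simp only [sepWeight, crossWeight, ← Finset.prod_mul_distrib]
  refine Finset.prod_congr rfl fun i _ => Finset.prod_congr rfl fun j _ => ?_
  have h1 := @IsChamber.adj _ _ _ _ _ hC i j
  have h2 := @IsChamber.adj _ _ _ _ _ hD j i
  have h3 := hΓ i j
  simp only [cut] at h2
  simp only [cut, join]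
  by_cases hi : i ∈ S <;> by_cases hj : j ∈ S <;> by_cases hij : C i j <;>
    by_cases hji : D j i <;> simp_all

lemma sepApply_join (hD : IsChamber (cut S Γ) D) (hΓ : ∀ i j, Γ i j → Γ j i) :
    sepApply q Γ v (join Γ S D) = sepApply q (cut S Γ) (localize q Γ S v) D := by
  have hmaps : ∀ C ∈ chambers Γ, cut S C ∈ chambers (cut S Γ) := fun C hC =>
    mem_chambers.2 (isChamber_cut (mem_chambers.1 hC) S)
  rw [sepApply, ← Finset.sum_fiberwise_of_maps_to hmaps, sepApply]
  refine Finset.sum_congr rfl fun r _ => ?_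
  rw [localize, Finset.mul_sum]
  refine Finset.sum_congr rfl fun C hC => ?_
  rw [Finset.mem_filter, mem_chambers] at hC
  rw [sepWeight_join hC.1 hD hΓ, hC.2, mul_assoc]

lemma foldSum_eq_zero (hΓ : ∀ i j, Γ i j → Γ j i)
    (h : ∀ r, IsChamber (cut S Γ) r → localize q Γ S v r = 0) : foldSum q Γ S v D = 0 := by
  rcases ((chambers Γ).filter (fun C => fold Γ S C = D)).eq_empty_or_nonempty with he | ⟨C₀, hC₀⟩
  · rw [foldSum, he, Finset.sum_empty]
  rw [Finset.mem_filter, mem_chambers] at hC₀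
  have hiff : ∀ C, fold Γ S C = D ↔ cut S C = cut S C₀ := by
    intro C
    rw [← hC₀.2]
    constructor <;>
    · intro h
      funext i j
      have h1 := congrFun (congrFun h i) j
      have h2 := congrFun (congrFun h j) i
      simp only [fold, cut, eq_iff_iff] at h1 h2 ⊢
      by_cases hi : i ∈ S <;> by_cases hj : j ∈ S <;> simp_all
  have key : foldSum q Γ S v D = (∏ i, ∏ j, if i ∈ S ∧ j ∈ S ∧ D j i then q i j else 1) *
      localize q Γ S v (cut S C₀) := by
    simp only [localize, Finset.mul_sum, foldSum, hiff]
    refine Finset.sum_congr rfl fun C hC => ?_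
    rw [Finset.mem_filter, mem_chambers, ← hiff] at hC
    rw [← mul_assoc]
    congr 1
    simp only [sepWeight, crossWeight, ← Finset.prod_mul_distrib]
    refine Finset.prod_congr rfl fun i _ => Finset.prod_congr rfl fun j _ => ?_
    have h1 : D j i ↔ fold Γ S C j i := by rw [hC.2]
    have h2 := @IsChamber.asymm _ _ _ _ _ hC.1 i j
    have h3 := @IsChamber.adj _ _ _ _ _ hC.1 i j
    have h5 := hΓ i j
    simp only [fold] at h1
    clear hC hC₀ hiff h
    by_cases hi : i ∈ S <;> by_cases hj : j ∈ S <;> by_cases hij : C i j <;> simp_all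
  rw [key, h _ (isChamber_cut hC₀.1 S), mul_zero]

lemma fold_insert (hΓ : ∀ i j, Γ i j → Γ j i) (hC : IsChamber Γ C) {x : G} (hx : x ∉ S)
    (hsrc : ∀ j, ¬ C j x) : fold Γ (insert x S) C = fold Γ S C := by
  funext i j
  have h1 := @IsChamber.adj _ _ _ _ _ hC i j
  have h2 := @IsChamber.total _ _ _ _ _ hΓ hC i j
  have h3 := hΓ i j
  have h4 := hC.irrefl x
  have h5 := hsrc i
  have h6 := hsrc j
  have h7 := @IsChamber.adj _ _ _ _ _ hC j i
  simp only [fold, Finset.mem_insert, eq_iff_iff]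
  by_cases hix : i = x
  · subst hix
    by_cases hjx : j = i
    · subst hjx
      simp_all
    · by_cases hj : j ∈ S <;> simp_all
      tauto
  · by_cases hjx : j = x
    · subst hjx
      by_cases hi : i ∈ S <;> simp_all
      tauto
    · simp only [hix, hjx, false_or]

lemma sum_foldSum (hΓ : ∀ i j, Γ i j → Γ j i) (hK : IsClosedUnder Γ K) (hne : K.Nonempty)
    (D : G → G → Prop) : ∑ S ∈ K.powerset, (-1) ^ S.card * foldSum q Γ S v D = 0 := by
  simp only [foldSum, Finset.sum_filter, Finset.mul_sum]
  rw [Finset.sum_comm]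
  refine Finset.sum_eq_zero fun C hC => ?_
  rw [mem_chambers] at hC
  obtain ⟨x, hxK, hx⟩ := hC.exists_source hne
  have hsrc : ∀ j, ¬ C j x := fun j hj =>
    hx j (hK x hxK j (hΓ _ _ (hC.adj hj))) hj
  rw [← Finset.insert_erase hxK, Finset.sum_powerset_insert (Finset.notMem_erase x K),
    ← Finset.sum_add_distrib]
  refine Finset.sum_eq_zero fun S hS => ?_
  have hxS : x ∉ S := fun h => Finset.notMem_erase x K (Finset.mem_powerset.1 hS h)
  rw [fold_insert hΓ hC hxS hsrc, Finset.card_insert_of_notMem hxS]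
  ring

lemma fold_empty (Γ C : G → G → Prop) : fold Γ ∅ C = C := by
  funext i j
  simp [fold]

lemma isChamber_fold (hΓ : ∀ i j, Γ i j → Γ j i) (hK : IsClosedUnder Γ K) (h : IsChamber Γ C) :
    IsChamber Γ (fold Γ K C) := by
  obtain ⟨f, h1, h2⟩ := h
  have hb : ∀ i, f i ≤ ∑ k, f k := fun i =>
    Finset.single_le_sum (fun _ _ => Nat.zero_le _) (Finset.mem_univ i)
  refine ⟨fun i => if i ∈ K then ∑ k, f k - f i else f i, fun i j hij => ?_, fun i j => ?_⟩
  · have a1 := hb i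
    have a2 := hb j
    have a3 := h1 i j hij
    have a4 := fun hi => hK i hi j hij
    have a5 := fun hj => hK j hj i (hΓ _ _ hij)
    by_cases hi : i ∈ K <;> by_cases hj : j ∈ K <;> simp [hi, hj]
    · omega
    · exact absurd (a4 hi) hj
    · exact absurd (a5 hj) hi
    · exact a3
  · have a1 := hb i
    have a2 := hb j
    have a4 := fun hi => hK i hi j
    have a5 := fun hj => hK j hj i
    have a6 := hΓ i j
    have a7 := hΓ j i
    simp only [fold, h2]
    by_cases hi : i ∈ K <;> by_cases hj : j ∈ K <;> simp only [hi, hj, if_true, if_false]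
    · constructor
      · rintro ⟨h, h'⟩
        exact ⟨a7 h, by omega⟩
      · rintro ⟨h, h'⟩
        exact ⟨a6 h, by omega⟩
    · exact iff_of_false (fun h => hj (a4 hi h)) (fun h => hj (a4 hi h.1))
    · exact iff_of_false id (fun h => hi (a5 hj (a6 h.1)))

lemma fold_fold (hΓ : ∀ i j, Γ i j → Γ j i) (hK : IsClosedUnder Γ K) (h : IsChamber Γ C) :
    fold Γ K (fold Γ K C) = C := by
  funext i j
  have a4 := fun hi => hK i hi j
  have a5 := fun hj => hK j hj i
  have a6 := hΓ i j
  have a8 := @IsChamber.adj _ _ _ _ _ h i j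
  simp only [fold, eq_iff_iff]
  by_cases hi : i ∈ K <;> by_cases hj : j ∈ K <;> simp only [hi, hj, if_true, if_false] <;> tauto

lemma foldSum_of_isClosedUnder (hΓ : ∀ i j, Γ i j → Γ j i) (hK : IsClosedUnder Γ K)
    (hD : IsChamber Γ D) :
    foldSum q Γ K v D = sepWeight q (fold Γ K D) D * v (fold Γ K D) := by
  have : (chambers Γ).filter (fun C => fold Γ K C = D) = {fold Γ K D} := by
    ext C
    rw [Finset.mem_filter, mem_chambers, Finset.mem_singleton]
    constructor
    · rintro ⟨h1, rfl⟩
      exact (fold_fold hΓ hK h1).symm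
    · rintro rfl
      exact ⟨isChamber_fold hΓ hK hD, fold_fold hΓ hK hD⟩
  rw [foldSum, this, Finset.sum_singleton]

lemma antipode (hΓ : ∀ i j, Γ i j → Γ j i) (hK : IsClosedUnder Γ K) (hne : K.Nonempty)
    (hD : IsChamber Γ D)
    (h : ∀ S ⊆ K, S.Nonempty → S ≠ K → foldSum q Γ S v D = 0) :
    v D + (-1) ^ K.card * (sepWeight q (fold Γ K D) D * v (fold Γ K D)) = 0 := by
  have hsum := sum_foldSum (q := q) (v := v) hΓ hK hne D
  have hsub : ({∅, K} : Finset (Finset G)) ⊆ K.powerset := by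
    intro S hS
    rcases Finset.mem_insert.1 hS with rfl | hS
    · simp
    · simp [Finset.mem_singleton.1 hS]
  rw [← Finset.sum_subset hsub, Finset.sum_pair hne.ne_empty.symm,
    foldSum_of_isClosedUnder hΓ hK hD,
    foldSum_of_isClosedUnder hΓ (K := ∅) (by simp [IsClosedUnder]) hD, fold_empty,
    sepWeight_self hD] at hsum
  · simpa using hsum
  · intro S hS hS'
    rw [Finset.mem_insert, Finset.mem_singleton, not_or] at hS'
    rw [h S (Finset.mem_powerset.1 hS) (Finset.nonempty_iff_ne_empty.2 hS'.1) hS'.2, mul_zero]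

lemma sepWeight_fold_mul (hΓ : ∀ i j, Γ i j → Γ j i) (hK : IsClosedUnder Γ K)
    (hD : IsChamber Γ D) :
    sepWeight q (fold Γ K D) D * sepWeight q D (fold Γ K D) = edgeProd q Γ K := by
  simp only [sepWeight, edgeProd, ← Finset.prod_mul_distrib]
  refine Finset.prod_congr rfl fun i _ => Finset.prod_congr rfl fun j _ => ?_
  have a1 := @IsChamber.adj _ _ _ _ _ hD i j
  have a2 := @IsChamber.adj _ _ _ _ _ hD j i
  have a3 := @IsChamber.total _ _ _ _ _ hΓ hD i j
  have a4 := @IsChamber.asymm _ _ _ _ _ hD i j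
  have a5 := hΓ i j
  have a6 := hΓ j i
  have a7 := fun hi => hK i hi j
  have a8 := fun hj => hK j hj i
  simp only [fold]
  by_cases hi : i ∈ K <;> by_cases hj : j ∈ K <;> by_cases h1 : D i j <;> by_cases h2 : D j i <;>
    simp_all

lemma exists_component (hΓ : ∀ i j, Γ i j → Γ j i) (a : G) :
    ∃ K, a ∈ K ∧ IsClosedUnder Γ K ∧ IsInseparable Γ K := by
  obtain ⟨K, hK, hmin⟩ := (Finset.univ.filter fun K : Finset G =>
    a ∈ K ∧ IsClosedUnder Γ K).exists_min_image Finset.card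
      ⟨Finset.univ, by simp only [Finset.mem_filter]; simp [IsClosedUnder]⟩
  simp only [Finset.mem_filter, Finset.mem_univ, true_and] at hK hmin
  refine ⟨K, hK.1, hK.2, fun S hS hne hSK => ?_⟩
  by_contra! hcon
  by_cases ha : a ∈ S
  · have := hmin S ⟨ha, fun i hi j hij => by
      by_contra hj
      exact hcon i hi j (hK.2 i (hS hi) j hij) hj hij⟩
    exact hSK (Finset.eq_of_subset_of_card_le hS this)
  · have := hmin (K \ S) ⟨by simp [hK.1, ha], fun i hi j hij => by
      rw [Finset.mem_sdiff] at hi ⊢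
      refine ⟨hK.2 i hi.1 j hij, fun hj => ?_⟩
      exact hcon j hj i hi.1 hi.2 (hΓ _ _ hij)⟩
    have h2 := Finset.card_sdiff_add_card_eq_card hS
    have h3 := hne.card_pos
    omega

/-- The number of ordered adjacent pairs. -/
def edgeCount (Γ : G → G → Prop) : ℕ := (Finset.univ.filter fun p : G × G => Γ p.1 p.2).card

lemma edgeCount_cut_lt {i j : G} (hij : Γ i j) (h : ¬ (i ∈ S ↔ j ∈ S)) :
    edgeCount (cut S Γ) < edgeCount Γ := by
  refine Finset.card_lt_card ⟨fun p hp => ?_, fun hsub => ?_⟩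
  · simp only [Finset.mem_filter, Finset.mem_univ, true_and] at hp ⊢
    exact hp.1
  · have : (i, j) ∈ _ := hsub (by simpa using hij)
    simp only [Finset.mem_filter, Finset.mem_univ, true_and] at this
    exact h this.2

lemma IsInseparable.subset_or_disjoint (h : IsInseparable (cut S Γ) K) :
    K ⊆ S ∨ Disjoint K S := by
  by_contra! hcon
  obtain ⟨i, hi, j, hj, hjS, hij⟩ := h (K ∩ S) Finset.inter_subset_left
    (by rw [← Finset.not_disjoint_iff_nonempty_inter]; exact hcon.2)
    (fun he => hcon.1 (Finset.inter_eq_left.1 he))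
  rw [Finset.mem_inter] at hi hjS
  exact hjS ⟨hj, hij.2.1 hi.2⟩

lemma IsInseparable.of_cut (h : IsInseparable (cut S Γ) K) : IsInseparable Γ K := by
  intro T hT hne hTK
  obtain ⟨i, hi, j, hj, hjS, hij⟩ := h T hT hne hTK
  exact ⟨i, hi, j, hj, hjS, hij.1⟩

lemma edgeProd_cut (h : K ⊆ S ∨ Disjoint K S) : edgeProd q (cut S Γ) K = edgeProd q Γ K := by
  refine Finset.prod_congr rfl fun i _ => Finset.prod_congr rfl fun j _ => ?_
  have : i ∈ K → j ∈ K → (i ∈ S ↔ j ∈ S) := by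
    intro hi hj
    rcases h with h | h
    · simp [h hi, h hj]
    · simp [Finset.disjoint_left.1 h hi, Finset.disjoint_left.1 h hj]
  simp only [cut]
  congr 1
  simp only [eq_iff_iff]
  tauto

lemma eq_zero_of_sepApply_eq_zero (hΓ : ∀ i j, Γ i j → Γ j i)
    (hgen : ∀ K : Finset G, 2 ≤ K.card → IsInseparable Γ K → edgeProd q Γ K ≠ 1)
    (hv : ∀ D, IsChamber Γ D → sepApply q Γ v D = 0) (hD : IsChamber Γ D) : v D = 0 := by
  induction hm : edgeCount Γ using Nat.strong_induction_on generalizing Γ v D with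
  | _ m ih =>
    by_cases hedge : ∃ a b, Γ a b
    · obtain ⟨a, b, hab⟩ := hedge
      obtain ⟨K, haK, hcl, hins⟩ := exists_component hΓ a
      have hKne : K.Nonempty := ⟨a, haK⟩
      have hbK := hcl a haK b hab
      have hne : a ≠ b := by
        rintro rfl
        exact hD.irrefl a hab
      have hanti : ∀ D, IsChamber Γ D →
          v D + (-1) ^ K.card * (sepWeight q (fold Γ K D) D * v (fold Γ K D)) = 0 := by
        intro D hD
        refine antipode hΓ hcl hKne hD fun S hS hne hSK => foldSum_eq_zero hΓ fun r hr => ?_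
        obtain ⟨i, hi, j, -, hjS, hij⟩ := hins S hS hne hSK
        refine ih (edgeCount (cut S Γ)) ?_ (cut_symm hΓ S) ?_ ?_ hr rfl
        · rw [← hm]
          exact edgeCount_cut_lt hij (by simp [hi, hjS])
        · intro L hL hLi
          rw [edgeProd_cut hLi.subset_or_disjoint]
          exact hgen L hL hLi.of_cut
        · intro D hD
          rw [← sepApply_join hD hΓ]
          exact hv _ (isChamber_join hD)
      have h1 := hanti D hD
      have h2 := hanti _ (isChamber_fold hΓ hcl hD)
      rw [fold_fold hΓ hcl hD] at h2
      have h3 := sepWeight_fold_mul (q := q) hΓ hcl hD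
      have h4 : ((-1 : ℂ) ^ K.card) * (-1) ^ K.card = 1 := by
        rw [← mul_pow]
        simp
      have h5 := hgen K (Finset.one_lt_card.2 ⟨a, haK, b, hbK, hne⟩) hins
      have h6 : (1 - edgeProd q Γ K) * v D = 0 := by
        linear_combination h1 - (-1) ^ K.card * sepWeight q (fold Γ K D) D * h2 + v D * h3 +
          sepWeight q (fold Γ K D) D * sepWeight q D (fold Γ K D) * v D * h4
      rcases mul_eq_zero.1 h6 with h | h
      · exact absurd (sub_eq_zero.1 h).symm h5
      · exact h
    · push Not at hedge
      have hch : chambers Γ = {D} := by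
        ext C
        rw [Finset.mem_singleton, mem_chambers]
        constructor
        · intro hC
          funext i j
          simp only [eq_iff_iff]
          exact iff_of_false (fun h => hedge _ _ (hC.adj h)) (fun h => hedge _ _ (hD.adj h))
        · rintro rfl
          exact hD
      have := hv D hD
      rwa [sepApply, hch, Finset.sum_singleton, sepWeight_self hD, one_mul] at this

lemma foldSum_eq_zero_of_not_adj {a b : G} (hab : Γ a b) (hD : D a b ↔ ¬ (a ∈ S ∧ b ∉ S))
    (hS : ¬ (a ∈ S ↔ b ∈ S)) : foldSum q Γ S v D = 0 := by
  refine Finset.sum_eq_zero fun C hC => ?_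
  obtain ⟨-, rfl⟩ := Finset.mem_filter.1 hC
  simp only [fold] at hD
  by_cases ha : a ∈ S <;> by_cases hb : b ∈ S <;> simp_all

lemma localize_eq_zero_of_half {a b : G} (hv : ∀ C, IsChamber Γ C → ¬ C a b → v C = 0)
    (hS : a ∈ S ↔ b ∈ S) {r : G → G → Prop} (hr : ¬ r a b) : localize q Γ S v r = 0 := by
  refine Finset.sum_eq_zero fun C hC => ?_
  rw [Finset.mem_filter, mem_chambers] at hC
  obtain ⟨hC, rfl⟩ := hC
  rw [hv C hC fun h => hr ⟨h, hS⟩, mul_zero]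

lemma eq_zero_of_half_sepApply_eq_zero {a b : G}
    (hΓ : ∀ i j, Γ i j → Γ j i) (hab : Γ a b)
    (hgen : ∀ K : Finset G, 2 ≤ K.card → IsInseparable Γ K → ¬ (a ∈ K ∧ b ∈ K) →
      edgeProd q Γ K ≠ 1)
    (hsupp : ∀ C, IsChamber Γ C → ¬ C a b → v C = 0)
    (hv : ∀ D, IsChamber Γ D → D a b → sepApply q Γ v D = 0) (hD : IsChamber Γ D) : v D = 0 := by
  induction hm : edgeCount Γ using Nat.strong_induction_on generalizing Γ v D with
  | _ m ih =>
    by_cases hDab : D a b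
    swap
    · exact hsupp D hD hDab
    obtain ⟨K, haK, hcl, hins⟩ := exists_component hΓ a
    have hbK := hcl a haK b hab
    have h1 : v D + (-1) ^ K.card * (sepWeight q (fold Γ K D) D * v (fold Γ K D)) = 0 := by
      refine antipode hΓ hcl ⟨a, haK⟩ hD fun S hS hne hSK => ?_
      obtain ⟨i, hi, j, -, hjS, hij⟩ := hins S hS hne hSK
      have hgenS : ∀ L : Finset G, 2 ≤ L.card → IsInseparable (cut S Γ) L →
          ¬ (a ∈ L ∧ b ∈ L) → edgeProd q (cut S Γ) L ≠ 1 := by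
        intro L hL hLi hab
        rw [edgeProd_cut hLi.subset_or_disjoint]
        exact hgen L hL hLi.of_cut hab
      by_cases hside : a ∈ S ↔ b ∈ S
      · refine foldSum_eq_zero hΓ fun r hr => ?_
        refine ih (edgeCount (cut S Γ)) ?_ (cut_symm hΓ S) ⟨hab, hside⟩ hgenS ?_ ?_ hr rfl
        · rw [← hm]
          exact edgeCount_cut_lt hij (by simp [hi, hjS])
        · exact fun C _ hC => localize_eq_zero_of_half hsupp hside hC
        · intro D hD hDab
          rw [← sepApply_join hD hΓ]
          exact hv _ (isChamber_join hD) (Or.inl hDab)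
      · by_cases hS' : a ∈ S ∧ b ∉ S
        · refine foldSum_eq_zero hΓ fun r hr => ?_
          refine eq_zero_of_sepApply_eq_zero (q := q) (cut_symm hΓ S) (fun L hL hLi => ?_)
            (fun D hD => ?_) hr
          · refine hgenS L hL hLi fun hL' => hside ?_
            rcases hLi.subset_or_disjoint with h | h
            · simp [h hL'.1, h hL'.2]
            · simp [Finset.disjoint_left.1 h hL'.1, Finset.disjoint_left.1 h hL'.2]
          · rw [← sepApply_join hD hΓ]
            exact hv _ (isChamber_join hD) (Or.inr ⟨hab, hS'⟩)
        · exact foldSum_eq_zero_of_not_adj hab (iff_of_true hDab hS') hside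
    have h2 : v (fold Γ K D) = 0 := by
      refine hsupp _ (isChamber_fold hΓ hcl hD) fun h => ?_
      simp only [fold, haK, hbK, if_true] at h
      exact hD.asymm hDab h
    rwa [h2, mul_zero, mul_zero, add_zero] at h1

lemma exists_half_sepApply_eq {a b : G}
    (hΓ : ∀ i j, Γ i j → Γ j i) (hab : Γ a b)
    (hgen : ∀ K : Finset G, 2 ≤ K.card → IsInseparable Γ K → ¬ (a ∈ K ∧ b ∈ K) →
      edgeProd q Γ K ≠ 1) (f : (G → G → Prop) → ℂ) :
    ∃ u : (G → G → Prop) → ℂ, (∀ C, ¬ C a b → u C = 0) ∧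
      ∀ D, IsChamber Γ D → D a b → sepApply q Γ u D = f D := by
  let H := {C : G → G → Prop // IsChamber Γ C ∧ C a b}
  let ext : (H → ℂ) →ₗ[ℂ] ((G → G → Prop) → ℂ) :=
    { toFun := fun w C => if h : IsChamber Γ C ∧ C a b then w ⟨C, h⟩ else 0
      map_add' := fun x y => by
        funext C
        by_cases h : IsChamber Γ C ∧ C a b <;> simp [h]
      map_smul' := fun c x => by
        funext C
        by_cases h : IsChamber Γ C ∧ C a b <;> simp [h] }
  let T : (H → ℂ) →ₗ[ℂ] (H → ℂ) :=
    { toFun := fun w D => sepApply q Γ (ext w) D.1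
      map_add' := fun x y => by
        funext D
        simp only [sepApply, map_add, Pi.add_apply, mul_add, Finset.sum_add_distrib]
      map_smul' := fun c x => by
        funext D
        simp only [sepApply, map_smul, Pi.smul_apply, smul_eq_mul, Finset.mul_sum,
          RingHom.id_apply]
        exact Finset.sum_congr rfl fun _ _ => by ring }
  have hext : ∀ w C, ¬ C a b → ext w C = 0 := fun w C hC => dif_neg fun h => hC h.2
  have hinj : Function.Injective T := by
    rw [injective_iff_map_eq_zero]
    intro w hw
    funext D
    have := eq_zero_of_half_sepApply_eq_zero (v := ext w) hΓ hab hgen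
      (fun C _ hC => hext w C hC) (fun D hD hDab => congrFun hw ⟨D, hD, hDab⟩) D.2.1
    rwa [show ext w D.1 = w D from dif_pos D.2] at this
  obtain ⟨w, hw⟩ := LinearMap.surjective_of_injective hinj fun D => f D.1
  exact ⟨ext w, hext w, fun D hD hDab => congrFun hw ⟨D, hD, hDab⟩⟩

/-- Every vertex but `a` has an incoming edge and every vertex but `b` an outgoing one. -/
def IsBipolar (a b : G) (D : G → G → Prop) : Prop :=
  (∀ i, i ≠ a → ∃ j, D j i) ∧ ∀ i, i ≠ b → ∃ j, D i j

lemma IsBipolar.adj {a b : G} (hΓ : ∀ i j, Γ i j → Γ j i) (hab : Γ a b) (hD : IsChamber Γ D)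
    (h : IsBipolar a b D) : D a b := by
  obtain ⟨x, -, hx⟩ := hD.exists_source (S := Finset.univ) ⟨a, Finset.mem_univ a⟩
  have hxa : x = a := by
    by_contra hne
    obtain ⟨j, hj⟩ := h.1 x hne
    exact hx j (Finset.mem_univ j) hj
  subst hxa
  exact (hD.total hΓ hab).resolve_right (hx b (Finset.mem_univ b))

lemma IsBipolar.mem_of_separated {a b : G} (hD : IsChamber Γ D) (h : IsBipolar a b D)
    (hsep : ∀ i j, i ∉ S → j ∈ S → ¬ D i j) (hne : S.Nonempty) (hS : S ≠ Finset.univ) :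
    a ∈ S ∧ b ∉ S := by
  constructor
  · obtain ⟨x, hxS, hx⟩ := hD.exists_source hne
    by_contra ha
    obtain ⟨j, hj⟩ := h.1 x (fun h => ha (h ▸ hxS))
    by_cases hjS : j ∈ S
    · exact hx j hjS hj
    · exact hsep j x hjS hxS hj
  · obtain ⟨x, hxS, hx⟩ := hD.exists_sink (S := Sᶜ)
      (by rwa [Finset.nonempty_iff_ne_empty, Ne, Finset.compl_eq_empty_iff])
    rw [Finset.mem_compl] at hxS
    intro hb
    obtain ⟨j, hj⟩ := h.2 x (fun h => hxS (h ▸ hb))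
    by_cases hjS : j ∈ S
    · exact hsep x j hxS hjS hj
    · exact hx j (Finset.mem_compl.2 hjS) hj

lemma IsBipolar.mem_of_join {a b : G} {r : G → G → Prop} (hr : IsChamber (cut S Γ) r)
    (h : IsBipolar a b (join Γ S r)) (hne : S.Nonempty) (hS : S ≠ Finset.univ) :
    a ∈ S ∧ b ∉ S := by
  refine h.mem_of_separated (isChamber_join hr) (fun i j hi hj hij => ?_) hne hS
  rcases hij with hij | hij
  · exact hi ((hr.adj hij).2.2 hj)
  · exact hi hij.2.1

lemma isClosedUnder_univ (Γ : G → G → Prop) : IsClosedUnder Γ Finset.univ :=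
  fun _ _ j _ => Finset.mem_univ j

lemma IsInseparable.cut_ne_univ (hS : S.Nonempty) (hS' : S ≠ Finset.univ)
    (h : IsInseparable (cut S Γ) K) : K ≠ Finset.univ := by
  rintro rfl
  rcases h.subset_or_disjoint with h | h
  · exact hS' (Finset.univ_subset_iff.1 h)
  · obtain ⟨x, hx⟩ := hS
    exact Finset.disjoint_left.1 h (Finset.mem_univ x) hx

lemma localize_eq_zero (hΓ : ∀ i j, Γ i j → Γ j i)
    (hgen : ∀ K : Finset G, K ≠ Finset.univ → 2 ≤ K.card → IsInseparable Γ K →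
      edgeProd q Γ K ≠ 1)
    (hne : S.Nonempty) (hS : S ≠ Finset.univ)
    (hv : ∀ r, IsChamber (cut S Γ) r → sepApply q Γ v (join Γ S r) = 0)
    {r : G → G → Prop} (hr : IsChamber (cut S Γ) r) : localize q Γ S v r = 0 := by
  refine eq_zero_of_sepApply_eq_zero (q := q) (cut_symm hΓ S) (fun L hL hLi => ?_) (fun D hD => ?_) hr
  · rw [edgeProd_cut hLi.subset_or_disjoint]
    exact hgen L (hLi.cut_ne_univ hne hS) hL hLi.of_cut
  · rw [← sepApply_join hD hΓ]
    exact hv D hD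

lemma localize_sub (q : G → G → ℂ) (Γ : G → G → Prop) (S : Finset G)
    (v w : (G → G → Prop) → ℂ) (r : G → G → Prop) :
    localize q Γ S (v - w) r = localize q Γ S v r - localize q Γ S w r := by
  simp only [localize, Pi.sub_apply, mul_sub, Finset.sum_sub_distrib]

lemma sepApply_sub (q : G → G → ℂ) (Γ : G → G → Prop)
    (v w : (G → G → Prop) → ℂ) (r : G → G → Prop) :
    sepApply q Γ (v - w) r = sepApply q Γ v r - sepApply q Γ w r := by
  simp only [sepApply, Pi.sub_apply, mul_sub, Finset.sum_sub_distrib]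

lemma eq_neg_fold_of_fold (hΓ : ∀ i j, Γ i j → Γ j i) (hσ : edgeProd q Γ Finset.univ = 1)
    (hD : IsChamber Γ D)
    (h : v (fold Γ Finset.univ D) + (-1) ^ (Finset.univ : Finset G).card *
      (sepWeight q D (fold Γ Finset.univ D) * v D) = 0) :
    v D + (-1) ^ (Finset.univ : Finset G).card *
      (sepWeight q (fold Γ Finset.univ D) D * v (fold Γ Finset.univ D)) = 0 := by
  have h3 := sepWeight_fold_mul (q := q) hΓ (isClosedUnder_univ Γ) hD
  rw [hσ] at h3
  have h4 : ((-1 : ℂ) ^ (Finset.univ : Finset G).card) * (-1) ^ (Finset.univ : Finset G).card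
      = 1 := by
    rw [← mul_pow]
    simp
  generalize (-1 : ℂ) ^ (Finset.univ : Finset G).card = e at *
  linear_combination e * sepWeight q (fold Γ Finset.univ D) D * h -
    v D * h3 - sepWeight q (fold Γ Finset.univ D) D * sepWeight q D (fold Γ Finset.univ D)
      * v D * h4

lemma sepApply_eq_zero_of_bipolar_support {a b : G}
    (hΓ : ∀ i j, Γ i j → Γ j i) (hab : Γ a b)
    (hgen : ∀ K : Finset G, K ≠ Finset.univ → 2 ≤ K.card → IsInseparable Γ K →
      edgeProd q Γ K ≠ 1)
    (hσ : edgeProd q Γ Finset.univ = 1)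
    (hv : ∀ D, IsChamber Γ D → ¬ IsBipolar a b D → sepApply q Γ v D = 0)
    (hD : IsChamber Γ D) : sepApply q Γ v D = 0 := by
  have hgen' : ∀ K : Finset G, 2 ≤ K.card → IsInseparable Γ K → ¬ (a ∈ K ∧ b ∈ K) →
      edgeProd q Γ K ≠ 1 := by
    refine fun K hK hKi hab => hgen K ?_ hK hKi
    rintro rfl
    simp at hab
  have huniv : (Finset.univ : Finset G).Nonempty := ⟨a, Finset.mem_univ a⟩
  have hloc : ∀ S : Finset G, S.Nonempty → S ≠ Finset.univ → ¬ (a ∈ S ∧ b ∉ S) →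
      ∀ r, IsChamber (cut S Γ) r → localize q Γ S v r = 0 := by
    intro S hne hS hS' r hr
    refine localize_eq_zero hΓ hgen hne hS (fun r hr => ?_) hr
    exact hv _ (isChamber_join hr) fun hb => hS' (hb.mem_of_join hr hne hS)
  have hneg : ∀ D, IsChamber Γ D → ¬ D a b → v D + (-1) ^ (Finset.univ : Finset G).card *
      (sepWeight q (fold Γ Finset.univ D) D * v (fold Γ Finset.univ D)) = 0 := by
    intro D hD hDab
    refine antipode hΓ (isClosedUnder_univ Γ) huniv hD fun S _ hne hS => ?_
    by_cases hS' : a ∈ S ∧ b ∉ S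
    · exact foldSum_eq_zero_of_not_adj hab (iff_of_false hDab (not_not.2 hS')) (by simp [hS'])
    · exact foldSum_eq_zero hΓ (hloc S hne hS hS')
  have hrev : ∀ D, fold Γ Finset.univ D a b ↔ D b a := by
    intro D
    simp [fold]
  have hpos : ∀ D, IsChamber Γ D → D a b → v D + (-1) ^ (Finset.univ : Finset G).card *
      (sepWeight q (fold Γ Finset.univ D) D * v (fold Γ Finset.univ D)) = 0 := by
    intro D hD hDab
    refine eq_neg_fold_of_fold hΓ hσ hD ?_
    have := hneg _ (isChamber_fold hΓ (isClosedUnder_univ Γ) hD)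
      (fun h => hD.asymm hDab ((hrev D).1 h))
    rwa [fold_fold hΓ (isClosedUnder_univ Γ) hD] at this
  obtain ⟨u, hu, hMu⟩ := exists_half_sepApply_eq hΓ hab hgen' (sepApply q Γ v)
  have hu0 : ∀ D, IsChamber Γ D → u D = 0 := by
    intro D hD
    by_cases hDab : D a b
    swap
    · exact hu D hDab
    have key : (v - u) D + (-1) ^ (Finset.univ : Finset G).card *
        (sepWeight q (fold Γ Finset.univ D) D * (v - u) (fold Γ Finset.univ D)) = 0 := by
      refine antipode hΓ (isClosedUnder_univ Γ) huniv hD fun S _ hne hS => ?_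
      by_cases hside : a ∈ S ↔ b ∈ S
      · have hS' : ¬ (a ∈ S ∧ b ∉ S) := by tauto
        refine foldSum_eq_zero hΓ fun r hr => ?_
        rw [localize_sub, hloc S hne hS hS' r hr, zero_sub, neg_eq_zero]
        refine eq_zero_of_half_sepApply_eq_zero (q := q) (cut_symm hΓ S) ⟨hab, hside⟩ ?_ ?_ ?_ hr
        · intro L hL hLi hab
          rw [edgeProd_cut hLi.subset_or_disjoint]
          exact hgen' L hL hLi.of_cut hab
        · exact fun C _ hC => localize_eq_zero_of_half (fun C _ hC => hu C hC) hside hC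
        · intro r hr hrab
          rw [← sepApply_join hr hΓ, hMu _ (isChamber_join hr) (Or.inl hrab)]
          exact hv _ (isChamber_join hr) fun hb => hS' (hb.mem_of_join hr hne hS)
      · by_cases hS' : a ∈ S ∧ b ∉ S
        · refine foldSum_eq_zero hΓ fun r hr => localize_eq_zero hΓ hgen hne hS ?_ hr
          intro r hr
          rw [sepApply_sub, hMu _ (isChamber_join hr) (Or.inr ⟨hab, hS'⟩), sub_self]
        · exact foldSum_eq_zero_of_not_adj hab (iff_of_true hDab hS') hside
    have h0 := hu (fold Γ Finset.univ D) fun h => hD.asymm hDab ((hrev D).1 h)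
    simp only [Pi.sub_apply, h0, sub_zero] at key
    linear_combination hpos D hD hDab - key
  by_cases hb : IsBipolar a b D
  · rw [← hMu D hD (hb.adj hΓ hab hD)]
    exact Finset.sum_eq_zero fun C hC => by rw [hu0 C (mem_chambers.1 hC), mul_zero]
  · exact hv D hD hb

lemma eq_zero_of_bipolar_sepApply_eq_zero {a b : G}
    (hΓ : ∀ i j, Γ i j → Γ j i) (hab : Γ a b)
    (hgen : ∀ K : Finset G, K ≠ Finset.univ → 2 ≤ K.card → IsInseparable Γ K →
      edgeProd q Γ K ≠ 1)
    (hv : ∀ D, IsChamber Γ D → sepApply q Γ v D = 0)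
    (hbip : ∀ D, IsChamber Γ D → IsBipolar a b D →
      sepApply q Γ (fun C => if C a b then v C else 0) D = 0)
    (hD : IsChamber Γ D) : v D = 0 := by
  have huniv : (Finset.univ : Finset G).Nonempty := ⟨a, Finset.mem_univ a⟩
  have hloc : ∀ S : Finset G, S.Nonempty → S ≠ Finset.univ →
      ∀ r, IsChamber (cut S Γ) r → localize q Γ S v r = 0 := fun S hne hS r hr =>
    localize_eq_zero hΓ hgen hne hS (fun r hr => hv _ (isChamber_join hr)) hr
  have hhalf : ∀ S : Finset G, S.Nonempty → S ≠ Finset.univ → (a ∈ S ↔ b ∈ S) →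
      ∀ r, IsChamber (cut S Γ) r →
        localize q Γ S (fun C => if C a b then v C else 0) r = 0 := by
    intro S hne hS hside r hr
    by_cases hrab : r a b
    · refine Eq.trans (Finset.sum_congr rfl fun C hC => ?_) (hloc S hne hS r hr)
      obtain ⟨-, rfl⟩ := Finset.mem_filter.1 hC
      simp only [hrab.1, if_true]
    · exact localize_eq_zero_of_half (fun C _ hC => if_neg hC) hside hrab
  have hsep : ∀ S : Finset G, S.Nonempty → S ≠ Finset.univ → (a ∈ S ↔ b ∈ S) →
      ∀ D, IsChamber Γ D → (∀ i j, i ∉ S → j ∈ S → ¬ D i j) →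
        sepApply q Γ (fun C => if C a b then v C else 0) D = 0 := by
    intro S hne hS hside D hD hDS
    rw [← join_cut hD hΓ hDS, sepApply_join (isChamber_cut hD S) hΓ]
    refine Finset.sum_eq_zero fun C hC => ?_
    rw [hhalf S hne hS hside C (mem_chambers.1 hC), mul_zero]
  have hpos : ∀ D, IsChamber Γ D → D a b → v D = 0 := by
    intro D hD hDab
    have hne : a ≠ b := by
      rintro rfl
      exact hD.irrefl a hab
    have := eq_zero_of_half_sepApply_eq_zero (q := q) (v := fun C => if C a b then v C else 0)
      hΓ hab ?_ (fun C _ hC => if_neg hC) ?_ hD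
    · rwa [if_pos hDab] at this
    · refine fun K hK hKi hab => hgen K ?_ hK hKi
      rintro rfl
      simp at hab
    · intro D hD hDab
      by_cases hb : IsBipolar a b D
      · exact hbip D hD hb
      · rw [IsBipolar, not_and_or] at hb
        push Not at hb
        rcases hb with ⟨x, hxa, hx⟩ | ⟨x, hxb, hx⟩
        · have hxb : x ≠ b := fun h => hx a (h ▸ hDab)
          refine hsep {x} ⟨x, by simp⟩ ?_ (by simp [hxa.symm, hxb.symm]) D hD ?_
          · intro h
            have := Finset.mem_univ a
            rw [← h, Finset.mem_singleton] at this
            exact hxa this.symm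
          · intro i j _ hj
            rw [Finset.mem_singleton] at hj
            exact hj ▸ hx i
        · have hxa : x ≠ a := fun h => hx b (h ▸ hDab)
          refine hsep {x}ᶜ ⟨a, by simp [hxa.symm]⟩ (by simp [Finset.compl_eq_univ_iff])
            (by simp [hxa.symm, hxb.symm]) D hD ?_
          intro i j hi _
          simp only [Finset.mem_compl, Finset.mem_singleton, not_not] at hi
          exact hi ▸ hx j
  by_cases hDab : D a b
  · exact hpos D hD hDab
  · have h1 := antipode (q := q) (v := v) hΓ (isClosedUnder_univ Γ) huniv hD
      fun S _ hne hS => foldSum_eq_zero hΓ (hloc S hne hS)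
    have h2 : fold Γ Finset.univ D a b := by
      simpa [fold] using (hD.total hΓ hab).resolve_left hDab
    rwa [hpos _ (isChamber_fold hΓ (isClosedUnder_univ Γ) hD) h2, mul_zero, mul_zero,
      add_zero] at h1

/-- Extension by zero from the acyclic orientations to all relations. -/
def extendZero (Γ : G → G → Prop) (w : {C // IsChamber Γ C} → ℂ) (C : G → G → Prop) : ℂ :=
  if h : IsChamber Γ C then w ⟨C, h⟩ else 0

/-- The matrix of separation weights, indexed by the acyclic orientations of `Γ`. -/
def sepMatrix (q : G → G → ℂ) (Γ : G → G → Prop) :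
    Matrix {C // IsChamber Γ C} {C // IsChamber Γ C} ℂ :=
  fun D C => sepWeight q C.1 D.1

lemma sepMatrix_mulVec (w : {C // IsChamber Γ C} → ℂ) (D : {C // IsChamber Γ C}) :
    (sepMatrix q Γ).mulVec w D = sepApply q Γ (extendZero Γ w) D := by
  rw [sepApply, Finset.sum_subtype (chambers Γ) (p := IsChamber Γ) (fun _ => mem_chambers)]
  refine Finset.sum_congr rfl fun C _ => ?_
  rw [extendZero, dif_pos C.2]
  rfl

theorem finrank_ker_sepMatrix {a b : G} (hΓ : ∀ i j, Γ i j → Γ j i) (hab : Γ a b)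
    (hgen : ∀ K : Finset G, K ≠ Finset.univ → 2 ≤ K.card → IsInseparable Γ K →
      edgeProd q Γ K ≠ 1)
    (hσ : edgeProd q Γ Finset.univ = 1) :
    Module.finrank ℂ (LinearMap.ker (sepMatrix q Γ).mulVecLin) =
      Fintype.card {C : {C // IsChamber Γ C} // IsBipolar a b C.1} := by
  set T := (sepMatrix q Γ).mulVecLin with hT
  apply le_antisymm
  · let φ : ({C // IsChamber Γ C} → ℂ) →ₗ[ℂ]
        ({C : {C // IsChamber Γ C} // IsBipolar a b C.1} → ℂ) :=
      { toFun := fun w D =>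
          sepApply q Γ (fun C => if C a b then extendZero Γ w C else 0) D.1.1
        map_add' := fun x y => by
          funext D
          simp only [sepApply, Pi.add_apply, ← Finset.sum_add_distrib]
          refine Finset.sum_congr rfl fun C _ => ?_
          by_cases h : C a b <;> by_cases h' : IsChamber Γ C <;> simp [h, h', extendZero, mul_add]
        map_smul' := fun c x => by
          funext D
          simp only [sepApply, Pi.smul_apply, smul_eq_mul, Finset.mul_sum, RingHom.id_apply]
          refine Finset.sum_congr rfl fun C _ => ?_
          by_cases h : C a b <;> by_cases h' : IsChamber Γ C <;> simp [h, h', extendZero]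
          ring }
    have hinj : Function.Injective (φ.domRestrict (LinearMap.ker T)) := by
      rw [injective_iff_map_eq_zero]
      rintro ⟨w, hw⟩ hφ
      rw [LinearMap.mem_ker] at hw
      ext D
      have := eq_zero_of_bipolar_sepApply_eq_zero (q := q) (v := extendZero Γ w) hΓ hab hgen
        (fun D hD => by
          rw [← sepMatrix_mulVec w ⟨D, hD⟩]
          exact congrFun hw ⟨D, hD⟩)
        (fun D hD hDb => congrFun hφ ⟨⟨D, hD⟩, hDb⟩) D.2
      rwa [extendZero, dif_pos D.2] at this
    simpa using LinearMap.finrank_le_finrank_of_injective hinj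
  · let ρ : ({C // IsChamber Γ C} → ℂ) →ₗ[ℂ]
        ({C : {C // IsChamber Γ C} // ¬ IsBipolar a b C.1} → ℂ) :=
      LinearMap.funLeft ℂ ℂ Subtype.val
    have hker : LinearMap.ker (ρ ∘ₗ T) = LinearMap.ker T := by
      refine le_antisymm (fun w hw => ?_) (LinearMap.ker_le_ker_comp T ρ)
      rw [LinearMap.mem_ker] at hw ⊢
      funext D
      refine (sepMatrix_mulVec w D).trans ?_
      refine sepApply_eq_zero_of_bipolar_support hΓ hab hgen hσ (fun D hD hDb => ?_) D.2
      rw [← sepMatrix_mulVec w ⟨D, hD⟩]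
      exact congrFun hw ⟨⟨D, hD⟩, hDb⟩
    have h1 := LinearMap.finrank_range_add_finrank_ker (ρ ∘ₗ T)
    have h2 := Submodule.finrank_le (LinearMap.range (ρ ∘ₗ T))
    rw [hker] at h1
    rw [Module.finrank_fintype_fun_eq_card] at h1 h2
    have h3 := Fintype.card_subtype_compl
      (fun C : {C // IsChamber Γ C} => IsBipolar a b C.1)
    have h4 := Fintype.card_subtype_le (fun C : {C // IsChamber Γ C} => IsBipolar a b C.1)
    omega

end AcyclicOrientation

section Words

open AcyclicOrientation

variable {n : ℕ}

/-- The graph of the pairs of distinct indices not belonging to `P`. -/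
def nonCommuting (P : Finset (Sym2 (Fin n))) : Fin n → Fin n → Prop :=
  fun i j => s(i, j) ∉ P ∧ i ≠ j

/-- The orientation of `nonCommuting P` given by the order of the entries of a word. -/
def wordOrient (P : Finset (Sym2 (Fin n))) (α : Equiv.Perm (Fin n)) : Fin n → Fin n → Prop :=
  fun i j => nonCommuting P i j ∧ α.symm i < α.symm j

variable {P : Finset (Sym2 (Fin n))} {α β : Equiv.Perm (Fin n)}

lemma nonCommuting_symm (i j : Fin n) (h : nonCommuting P i j) : nonCommuting P j i :=
  ⟨by rw [Sym2.eq_swap]; exact h.1, h.2.symm⟩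

lemma isChamber_wordOrient (P : Finset (Sym2 (Fin n))) (α : Equiv.Perm (Fin n)) :
    IsChamber (nonCommuting P) (wordOrient P α) :=
  ⟨fun i => α.symm i, fun _ _ hij h => hij.2 (α.symm.injective (Fin.ext h)), fun _ _ => Iff.rfl⟩

lemma wordOrient_sort {f : Fin n → ℕ} (hf : ∀ i j, nonCommuting P i j → f i ≠ f j) (i j : Fin n) :
    wordOrient P (Tuple.sort f) i j ↔ nonCommuting P i j ∧ f i < f j := by
  have hmono : ∀ k l : Fin n, (Tuple.sort f).symm k ≤ (Tuple.sort f).symm l → f k ≤ f l := by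
    intro k l hkl
    simpa using Tuple.monotone_sort f hkl
  refine and_congr_right fun hij => ⟨fun h => ?_, fun h => ?_⟩
  · exact lt_of_le_of_ne (hmono i j h.le) (hf i j hij)
  · by_contra hcon
    exact absurd (hmono j i (not_lt.1 hcon)) (not_le.2 h)

lemma exists_wordOrient_eq {C : Fin n → Fin n → Prop} (hC : IsChamber (nonCommuting P) C) :
    ∃ α, wordOrient P α = C := by
  obtain ⟨f, h1, h2⟩ := hC
  refine ⟨Tuple.sort f, ?_⟩
  funext i j
  rw [eq_iff_iff, wordOrient_sort h1, h2]

lemma wordOrient_eq_of_swapRel (h : swapRel P α β) : wordOrient P α = wordOrient P β := by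
  obtain ⟨k, hk, hP, rfl⟩ := h
  funext i j
  rw [eq_iff_iff]
  refine and_congr_right fun hij => ?_
  obtain ⟨x, rfl⟩ := α.surjective i
  obtain ⟨y, rfl⟩ := α.surjective j
  have hxy : ¬ ((x : ℕ) = k ∧ (y : ℕ) = k + 1) := by
    rintro ⟨hx, hy⟩
    refine hij.1 ?_
    convert hP
  have hyx : ¬ ((y : ℕ) = k ∧ (x : ℕ) = k + 1) := by
    rintro ⟨hx, hy⟩
    refine hij.1 ?_
    rw [Sym2.eq_swap]
    convert hP
  simp only [Equiv.Perm.mul_def, Equiv.symm_trans_apply, Equiv.symm_apply_apply, Equiv.symm_swap,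
    Equiv.swap_apply_def, Fin.ext_iff, Fin.lt_def]
  split_ifs <;> simp only [] <;> omega

lemma wordOrient_eq_of_swapSetoid (h : (swapSetoid P) α β) :
    wordOrient P α = wordOrient P β := by
  have hle : swapSetoid P ≤ Setoid.ker (wordOrient P) :=
    Setoid.eqvGen_le fun _ _ => wordOrient_eq_of_swapRel
  exact hle h

lemma sum_mul_swap_lt (g : Fin n → ℤ) {x y : Fin n} (hxy : x < y) (h : g y < g x) :
    ∑ k : Fin n, (k : ℤ) * g k < ∑ k : Fin n, (k : ℤ) * g (Equiv.swap x y k) := by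
  rw [← sub_pos, ← Finset.sum_sub_distrib, Finset.sum_eq_add_of_mem x y (Finset.mem_univ x)
    (Finset.mem_univ y) hxy.ne]
  · rw [Equiv.swap_apply_left, Equiv.swap_apply_right]
    have h' : (x : ℤ) < y := by exact_mod_cast hxy
    nlinarith
  · rintro k - ⟨hx, hy⟩
    rw [Equiv.swap_apply_of_ne_of_ne hx hy, sub_self]

lemma swapSetoid_of_wordOrient_eq (h : wordOrient P α = wordOrient P β) :
    (swapSetoid P) α β := by
  classical
  obtain ⟨γ, hγ, hmax⟩ := (Finset.univ.filter fun γ => (swapSetoid P) α γ).exists_max_image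
    (fun γ => ∑ k : Fin n, (k : ℤ) * ((β.symm (γ k) : ℕ) : ℤ))
    ⟨α, by simp⟩
  simp only [Finset.mem_filter, Finset.mem_univ, true_and] at hγ hmax
  suffices hb : γ = β by rwa [← hb]
  have hmono : StrictMono fun k => β.symm (γ k) := by
    obtain _ | m := n
    · exact fun x => x.elim0
    rw [Fin.strictMono_iff_lt_succ]
    intro k
    by_contra hcon
    have hne : β.symm (γ k.succ) ≠ β.symm (γ k.castSucc) := by
      simp [Fin.ext_iff]
    have hlt := lt_of_le_of_ne (not_lt.1 hcon) hne
    have hP : s(γ k.castSucc, γ k.succ) ∈ P := by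
      by_contra hP
      have hadj : nonCommuting P (γ k.castSucc) (γ k.succ) :=
        ⟨hP, fun h => hne (by rw [h])⟩
      have h1 : wordOrient P γ (γ k.castSucc) (γ k.succ) := ⟨hadj, by simp [Fin.lt_def]⟩
      rw [← wordOrient_eq_of_swapSetoid hγ, h] at h1
      exact absurd h1.2 hlt.asymm
    have hrel : swapRel P γ (γ * Equiv.swap k.castSucc k.succ) :=
      ⟨k, by omega, hP, rfl⟩
    have hle := hmax _ ((swapSetoid P).trans hγ (Relation.EqvGen.rel _ _ hrel))
    refine absurd hle (not_le.2 ?_)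
    exact sum_mul_swap_lt (fun k => ((β.symm (γ k) : ℕ) : ℤ)) (Fin.castSucc_lt_succ)
      (by exact_mod_cast hlt)
  have hid : (fun k => β.symm (γ k)) = id := by
    refine (hmono.range_inj strictMono_id).1 ?_
    rw [Set.range_id]
    exact Set.range_eq_univ.2 (β.symm.surjective.comp γ.surjective)
  ext k
  have := congrFun hid k
  simp only [id, Equiv.symm_apply_eq] at this
  rw [this]

lemma swapSetoid_iff : (swapSetoid P) α β ↔ wordOrient P α = wordOrient P β :=
  ⟨wordOrient_eq_of_swapSetoid, swapSetoid_of_wordOrient_eq⟩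

lemma Mentry_eq_sepWeight {q : Fin n → Fin n → ℂ} (hsymm : ∀ i j, q i j = q j i)
    (P : Finset (Sym2 (Fin n))) (α β : Equiv.Perm (Fin n)) :
    Mentry q P α β = sepWeight q (wordOrient P β) (wordOrient P α) := by
  classical
  set g : Fin n × Fin n → ℂ := fun p =>
    if wordOrient P β p.1 p.2 ∧ wordOrient P α p.2 p.1 then q p.1 p.2 else 1 with hg
  have hsplit : ∀ p : Fin n × Fin n,
      g p = (if p.1 < p.2 then g p else 1) * (if p.2 < p.1 then g p else 1) := by
    intro p
    rcases lt_trichotomy p.1 p.2 with h | h | h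
    · rw [if_pos h, if_neg h.asymm, mul_one]
    · rw [if_neg h.not_lt, if_neg h.not_gt, mul_one, hg]
      exact if_neg fun hc => hc.1.1.2 h
    · rw [if_neg h.asymm, if_pos h, one_mul]
  have hswap : ∏ p : Fin n × Fin n, (if p.2 < p.1 then g p else 1) =
      ∏ p : Fin n × Fin n, (if p.1 < p.2 then g p.swap else 1) :=
    (Fintype.prod_equiv (Equiv.prodComm _ _) _ _ fun p => rfl).symm
  have hsep : sepWeight q (wordOrient P β) (wordOrient P α) = ∏ p : Fin n × Fin n, g p :=
    (Fintype.prod_prod_type' fun i j => g (i, j)).symm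
  rw [hsep, Finset.prod_congr rfl fun p _ => hsplit p, Finset.prod_mul_distrib, hswap,
    ← Finset.prod_mul_distrib, Mentry, Finset.prod_filter]
  refine Finset.prod_congr rfl fun p _ => ?_
  by_cases hlt : p.1 < p.2
  swap
  · simp [hlt]
  have hα : α.symm p.2 < α.symm p.1 ↔ ¬ α.symm p.1 < α.symm p.2 := by
    rw [not_lt, le_iff_lt_or_eq, or_iff_left fun h => hlt.ne' (α.symm.injective h)]
  have hβ : β.symm p.2 < β.symm p.1 ↔ ¬ β.symm p.1 < β.symm p.2 := by
    rw [not_lt, le_iff_lt_or_eq, or_iff_left fun h => hlt.ne' (β.symm.injective h)]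
  have hs : s(p.2, p.1) = s(p.1, p.2) := Sym2.eq_swap
  simp only [hg, wordOrient, nonCommuting, Prod.fst_swap, Prod.snd_swap, hα, hβ, hs, hlt,
    if_true, hlt.ne, hlt.ne', hsymm p.2 p.1, true_and, ne_eq, not_false_eq_true, and_true]
  by_cases hP : s(p.1, p.2) ∈ P <;> by_cases h1 : α.symm p.1 < α.symm p.2 <;>
    by_cases h2 : β.symm p.1 < β.symm p.2 <;> simp [hP, h1, h2]

lemma sigmaS_eq_edgeProd {q : Fin n → Fin n → ℂ} (hqP : ∀ i j : Fin n, s(i, j) ∈ P → q i j = 1)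
    (S : Finset (Fin n)) : sigmaS q S = edgeProd q (nonCommuting P) S := by
  classical
  rw [sigmaS, edgeProd, ← Finset.prod_filter_mul_prod_filter_not Finset.univ (· ∈ S)]
  rw [Finset.filter_mem_eq_inter, Finset.univ_inter]
  rw [Finset.prod_eq_one (s := Finset.univ.filter (· ∉ S)), mul_one]
  · refine Finset.prod_congr rfl fun i hi => ?_
    rw [← Finset.prod_subset (Finset.subset_univ S)]
    · refine Finset.prod_congr rfl fun j hj => ?_
      by_cases hP : s(i, j) ∈ P
      · simp [nonCommuting, hP, hqP i j hP]
      · simp [nonCommuting, hP, hi, hj]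
    · intro j _ hj
      simp [hj]
  · intro i hi
    simp [(Finset.mem_filter.1 hi).2]

lemma isBipolar_wordOrient_iff (a b : Fin n) (ha : (a : ℕ) = 0) (hb : (b : ℕ) = n - 1) :
    IsBipolar a b (wordOrient P α) ↔
      ∀ β : Equiv.Perm (Fin n), wordOrient P β = wordOrient P α → β a = a ∧ β b = b := by
  constructor
  · rintro ⟨h1, h2⟩ β hβ
    rw [← hβ] at h1 h2
    constructor
    · by_contra hne
      obtain ⟨j, -, hj⟩ := h1 (β a) hne
      rw [Equiv.symm_apply_apply, Fin.lt_def] at hj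
      omega
    · by_contra hne
      obtain ⟨j, -, hj⟩ := h2 (β b) hne
      rw [Equiv.symm_apply_apply, Fin.lt_def] at hj
      omega
  · intro h
    have key : ∀ f : Fin n → ℕ, Function.Injective f →
        (∀ i j, nonCommuting P i j → (f i < f j ↔ α.symm i < α.symm j)) →
        Tuple.sort f a = a ∧ Tuple.sort f b = b := by
      intro f hf hlt
      refine h _ ?_
      funext i j
      rw [eq_iff_iff, wordOrient_sort fun i j hij => hf.ne hij.2]
      exact and_congr_right (hlt i j)
    constructor
    · intro x hx
      by_contra! hno
      have hno' : ∀ j, nonCommuting P j x → α.symm x < α.symm j := fun j hj =>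
        lt_of_le_of_ne (not_lt.1 fun hl => hno j ⟨hj, hl⟩) (α.symm.injective.ne hj.2.symm)
      set f : Fin n → ℕ := fun i => if i = x then 0 else (α.symm i : ℕ) + 1 with hfdef
      have hf : Function.Injective f := by
        intro i j hij
        by_cases hi : i = x <;> by_cases hj : j = x <;> simp [hfdef, hi, hj] at hij ⊢
        exact α.symm.injective (Fin.ext hij)
      have := key f hf fun i j hij => by
        by_cases hi : i = x <;> by_cases hj : j = x
        · exact absurd (hi.trans hj.symm) hij.2
        · subst hi
          simp [hfdef, hj, hno' j (nonCommuting_symm _ _ hij)]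
        · subst hj
          simp [hfdef, hi, (hno' i hij).le]
        · simp [hfdef, hi, hj]
      have hle : f (Tuple.sort f a) ≤ f x := by
        have := Tuple.monotone_sort f (show a ≤ (Tuple.sort f).symm x by
          rw [Fin.le_def]; omega)
        simpa using this
      rw [this.1] at hle
      simp [hfdef, hx.symm] at hle
    · intro x hx
      by_contra! hno
      have hno' : ∀ j, nonCommuting P x j → α.symm j < α.symm x := fun j hj =>
        lt_of_le_of_ne (not_lt.1 fun hl => hno j ⟨hj, hl⟩) (α.symm.injective.ne hj.2.symm)
      set f : Fin n → ℕ := fun i => if i = x then n else (α.symm i : ℕ) with hfdef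
      have hf : Function.Injective f := by
        intro i j hij
        have := (α.symm i).isLt
        have := (α.symm j).isLt
        by_cases hi : i = x <;> by_cases hj : j = x <;> simp [hfdef, hi, hj] at hij ⊢
        · omega
        · omega
        exact α.symm.injective (Fin.ext hij)
      have := key f hf fun i j hij => by
        by_cases hi : i = x <;> by_cases hj : j = x
        · exact absurd (hi.trans hj.symm) hij.2
        · subst hi
          simp [hfdef, hj, (hno' j hij).not_gt, (α.symm j).isLt.not_gt]
        · subst hj
          simp [hfdef, hi, hno' i (nonCommuting_symm _ _ hij)]
        · simp [hfdef, hi, hj]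
      have hle : f x ≤ f (Tuple.sort f b) := by
        have := Tuple.monotone_sort f (show (Tuple.sort f).symm x ≤ b by
          rw [Fin.le_def]; omega)
        simpa using this
      rw [this.2] at hle
      simp [hfdef, hx.symm] at hle
      omega

/-- The classes of words correspond to the acyclic orientations of `nonCommuting P`. -/
def quotientEquivChamber (P : Finset (Sym2 (Fin n))) :
    Quotient (swapSetoid P) ≃ {C // IsChamber (nonCommuting P) C} :=
  Equiv.ofBijective
    (Quotient.lift (fun α => ⟨wordOrient P α, isChamber_wordOrient P α⟩)
      fun _ _ h => Subtype.ext (wordOrient_eq_of_swapSetoid h))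
    ⟨by
      rintro ⟨α⟩ ⟨β⟩ h
      exact Quotient.sound (swapSetoid_of_wordOrient_eq (congrArg Subtype.val h)),
    fun C => (exists_wordOrient_eq C.2).elim fun α hα => ⟨Quotient.mk _ α, Subtype.ext hα⟩⟩

lemma finrank_ker_submatrix_equiv {ι κ : Type*} [Fintype ι] [Fintype κ] (e : ι ≃ κ)
    (A : Matrix κ κ ℂ) :
    Module.finrank ℂ (LinearMap.ker (A.submatrix e e).mulVecLin) =
      Module.finrank ℂ (LinearMap.ker A.mulVecLin) := by
  classical
  have h1 := (A.submatrix e e).mulVecLin.finrank_range_add_finrank_ker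
  have h2 := A.mulVecLin.finrank_range_add_finrank_ker
  have h3 : (A.submatrix e e).rank = A.rank := Matrix.rank_submatrix A e e
  rw [Matrix.rank, Matrix.rank] at h3
  rw [Module.finrank_fintype_fun_eq_card] at h1 h2
  have := Fintype.card_congr e
  omega

end Words

/-- For `n > 2`, `P` a set of unordered pairs of distinct indices with
`{1,n} ∉ P`, and `q` symmetric with nonzero entries, `q_{ij} = 1` on `P`, `σ_S ≠ 1` for
every proper subset with at least two elements which is not a `P`-pair, and
`σ_{1⋯n} = 1`: the assignment `M([α],[β]) = ∏ q_{ij}` (product over unordered pairs not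
in `P` whose relative order in `α` and in `β` differs) is a well-defined matrix on the
equivalence classes of permutations, and the dimension of its kernel equals the number of
equivalence classes all of whose members begin with `1` and end with `n`. -/
theorem stmt12 (n : ℕ) (hn : 2 < n) (q : Fin n → Fin n → ℂ) (hq : ∀ i j, q i j ≠ 0)
    (hsymm : ∀ i j, q i j = q j i)
    (P : Finset (Sym2 (Fin n)))
    (hPdiag : ∀ p ∈ P, ¬ p.IsDiag)
    (hP1n : s((⟨0, by omega⟩ : Fin n), (⟨n - 1, by omega⟩ : Fin n)) ∉ P)
    (hqP : ∀ i j : Fin n, s(i, j) ∈ P → q i j = 1)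
    (hgen : ∀ S : Finset (Fin n), S ≠ Finset.univ → 2 ≤ S.card →
      (¬ ∃ i j : Fin n, i ≠ j ∧ S = {i, j} ∧ s(i, j) ∈ P) → sigmaS q S ≠ 1)
    (hσ : sigmaS q Finset.univ = 1) :
    ∃ M : Matrix (Quotient (swapSetoid P)) (Quotient (swapSetoid P)) ℂ,
      (∀ α β : Equiv.Perm (Fin n),
        M (Quotient.mk (swapSetoid P) α) (Quotient.mk (swapSetoid P) β) = Mentry q P α β) ∧
      Module.finrank ℂ (LinearMap.ker M.mulVecLin) =
        Nat.card {c : Quotient (swapSetoid P) //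
          ∀ α : Equiv.Perm (Fin n), Quotient.mk (swapSetoid P) α = c →
            α ⟨0, by omega⟩ = ⟨0, by omega⟩ ∧ α ⟨n - 1, by omega⟩ = ⟨n - 1, by omega⟩} := by
  classical
  have hab : nonCommuting P ⟨0, by omega⟩ ⟨n - 1, by omega⟩ :=
    ⟨hP1n, by rw [Ne, Fin.ext_iff]; simp only; omega⟩
  refine ⟨(AcyclicOrientation.sepMatrix q (nonCommuting P)).submatrix (quotientEquivChamber P)
    (quotientEquivChamber P), fun α β => (Mentry_eq_sepWeight hsymm P α β).symm, ?_⟩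
  rw [finrank_ker_submatrix_equiv,
    AcyclicOrientation.finrank_ker_sepMatrix nonCommuting_symm hab, ← Nat.card_eq_fintype_card]
  · refine (Nat.card_congr ((quotientEquivChamber P).subtypeEquiv ?_)).symm
    rintro ⟨α⟩
    refine Iff.trans ?_ (isBipolar_wordOrient_iff (P := P) (α := α) _ _ rfl rfl).symm
    refine forall_congr' fun β => imp_congr_left ?_
    exact Quotient.eq.trans swapSetoid_iff
  · intro K hK hcard hins
    rw [← sigmaS_eq_edgeProd hqP]
    refine hgen K hK hcard ?_
    rintro ⟨i, j, hij, rfl, hP⟩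
    obtain ⟨k, hk, l, hl, hlk, hΓ⟩ := hins {i} (by simp) (by simp) fun h => hij.symm <| by
      have : j ∈ ({i} : Finset (Fin n)) := h ▸ by simp
      simpa using this
    obtain rfl := Finset.mem_singleton.1 hk
    have : l = j := by simpa [Finset.mem_singleton.not.1 hlk] using hl
    exact hΓ.1 (this ▸ hP)
  · rw [← sigmaS_eq_edgeProd hqP, hσ]

end
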